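/- Let d_A, d_B, d_E be positive integers. Let A₀, A₁ be Hermitian d_A × d_A matrices with A_x² ≤ 𝟙, let B₀, B₁ be Hermitian d_B × d_B matrices with B_y² ≤ 𝟙, let {N_{ij}}_{i,j∈{0,1}} be positive semidefinite d_E × d_E matrices with ∑_{i,j} N_{ij} = 𝟙, and let ρ be a density matrix on ℂ^{d_A} ⊗ ℂ^{d_B} ⊗ ℂ^{d_E}. For i,j ∈ {0,1} set I^{ij} = (−1)^{i+j} A₀ ⊗ (B₀ − B₁) + (−1)^i A₁ ⊗ (B₀ + B₁), and suppose p_{ij} := Tr[(𝟙 ⊗ 𝟙 ⊗ N_{ij}) ρ] > 0 for all i,j. If ∑_{i,j} Tr[(I^{ij} ⊗ N_{ij}) ρ] = 2√2, then Tr[(I^{ij} ⊗ N_{ij}) ρ] = 2√2 · p_{ij} for every i,j ∈ {0,1}. -/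

import Mathlib

open Matrix Kronecker
open scoped ComplexOrder

namespace Matrix

open scoped MatrixOrder Matrix.Norms.L2Operator ComplexOrder in
theorem PosSemidef.trace_mul_nonneg {n 𝕜 : Type*} [Fintype n] [DecidableEq n] [RCLike 𝕜]
    {P Q : Matrix n n 𝕜} (hP : P.PosSemidef) (hQ : Q.PosSemidef) : 0 ≤ (P * Q).trace := by
  obtain ⟨C, rfl⟩ := CStarAlgebra.nonneg_iff_eq_star_mul_self.1 hP.nonneg
  rw [star_eq_conjTranspose, mul_assoc, trace_mul_comm]
  exact (hQ.mul_mul_conjTranspose_same C).trace_nonneg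

theorem IsHermitian.posSemidef_mul_self {n 𝕜 : Type*} [Fintype n] [RCLike 𝕜]
    {Z : Matrix n n 𝕜} (hZ : Z.IsHermitian) : (Z * Z).PosSemidef := by
  simpa only [hZ.eq] using posSemidef_conjTranspose_mul_self Z

theorem sub_kronecker {R l m n p : Type*} [Ring R] (A A' : Matrix l m R) (B : Matrix n p R) :
    (A - A') ⊗ₖ B = A ⊗ₖ B - A' ⊗ₖ B := by
  ext; simp [sub_mul]

theorem kronecker_sub {R l m n p : Type*} [Ring R] (A : Matrix l m R) (B B' : Matrix n p R) :
    A ⊗ₖ (B - B') = A ⊗ₖ B - A ⊗ₖ B' := by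
  ext; simp [mul_sub]

theorem kronecker_sum {R ι l m n p : Type*} [Semiring R] (s : Finset ι) (A : Matrix l m R)
    (B : ι → Matrix n p R) : A ⊗ₖ (∑ i ∈ s, B i) = ∑ i ∈ s, A ⊗ₖ B i := by
  ext; simp [sum_apply, Finset.mul_sum]

theorem IsHermitian.kronecker {R m n : Type*} [CommRing R] [StarRing R]
    {A : Matrix m m R} {B : Matrix n n R} (hA : A.IsHermitian) (hB : B.IsHermitian) :
    (A ⊗ₖ B).IsHermitian := by
  rw [IsHermitian, conjTranspose_kronecker, hA.eq, hB.eq]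

end Matrix

/-- Tsirelson's bound for commuting pairs of Hermitian contractions. -/
theorem posSemidef_two_sqrt_two_sub_chsh {n : Type*} [Fintype n] [DecidableEq n]
    {X₀ X₁ Y₀ Y₁ : Matrix n n ℂ}
    (hX₀ : X₀.IsHermitian) (hX₁ : X₁.IsHermitian) (hY₀ : Y₀.IsHermitian) (hY₁ : Y₁.IsHermitian)
    (hX₀sq : (1 - X₀ * X₀).PosSemidef) (hX₁sq : (1 - X₁ * X₁).PosSemidef)
    (hY₀sq : (1 - Y₀ * Y₀).PosSemidef) (hY₁sq : (1 - Y₁ * Y₁).PosSemidef)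
    (h₀₀ : Commute X₀ Y₀) (h₀₁ : Commute X₀ Y₁) (h₁₀ : Commute X₁ Y₀) (h₁₁ : Commute X₁ Y₁) :
    ((2 * √2) • 1 - (X₀ * (Y₀ - Y₁) + X₁ * (Y₀ + Y₁))).PosSemidef := by
  have hr : √2 * √2 = 2 := Real.mul_self_sqrt zero_le_two
  have hZ₀ : (√2 • X₀ - (Y₀ - Y₁)).IsHermitian :=
    (hX₀.smul (IsSelfAdjoint.all √2)).sub (hY₀.sub hY₁)
  have hZ₁ : (√2 • X₁ - (Y₀ + Y₁)).IsHermitian :=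
    (hX₁.smul (IsSelfAdjoint.all √2)).sub (hY₀.add hY₁)
  have hsos : (2 * √2) • (1 : Matrix n n ℂ) - (X₀ * (Y₀ - Y₁) + X₁ * (Y₀ + Y₁)) =
      (√2 / 4) • ((√2 • X₀ - (Y₀ - Y₁)) * (√2 • X₀ - (Y₀ - Y₁))
        + (√2 • X₁ - (Y₀ + Y₁)) * (√2 • X₁ - (Y₀ + Y₁)))
      + (√2 / 2) • ((1 - X₀ * X₀) + (1 - X₁ * X₁) + (1 - Y₀ * Y₀) + (1 - Y₁ * Y₁)) := by
    simp only [sub_mul, mul_sub, add_mul, mul_add, smul_mul_assoc, mul_smul_comm,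
      ← h₀₀.eq, ← h₀₁.eq, ← h₁₀.eq, ← h₁₁.eq]
    match_scalars <;> grind
  rw [hsos]
  exact ((hZ₀.posSemidef_mul_self.add hZ₁.posSemidef_mul_self).smul (by positivity)).add
    ((((hX₀sq.add hX₁sq).add hY₀sq).add hY₁sq).smul (by positivity))

/-- Key intermediate step in the proof of Theorem 1: if the weak-bilocality
functional `∑_{ij} Tr[(I^{ij} ⊗ N_{ij}) ρ]` attains the quantum maximum `2√2`
and every Eve outcome has positive probability `p_{ij}`, then each term
attains the conditional maximum: `Tr[(I^{ij} ⊗ N_{ij}) ρ] = 2√2 · p_{ij}`. -/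
theorem each_conditional_chsh_maximal {dA dB dE : ℕ}
    (hdA : 0 < dA) (hdB : 0 < dB) (hdE : 0 < dE)
    (A₀ A₁ : Matrix (Fin dA) (Fin dA) ℂ)
    (B₀ B₁ : Matrix (Fin dB) (Fin dB) ℂ)
    (hA₀ : A₀.IsHermitian) (hA₁ : A₁.IsHermitian)
    (hB₀ : B₀.IsHermitian) (hB₁ : B₁.IsHermitian)
    (hA₀sq : (1 - A₀ * A₀).PosSemidef) (hA₁sq : (1 - A₁ * A₁).PosSemidef)
    (hB₀sq : (1 - B₀ * B₀).PosSemidef) (hB₁sq : (1 - B₁ * B₁).PosSemidef)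
    (N : Fin 2 → Fin 2 → Matrix (Fin dE) (Fin dE) ℂ)
    (hN : ∀ i j, (N i j).PosSemidef) (hNsum : ∑ i, ∑ j, N i j = 1)
    (ρ : Matrix ((Fin dA × Fin dB) × Fin dE) ((Fin dA × Fin dB) × Fin dE) ℂ)
    (hρpsd : ρ.PosSemidef) (hρtr : ρ.trace = 1)
    (I : Fin 2 → Fin 2 → Matrix (Fin dA × Fin dB) (Fin dA × Fin dB) ℂ)
    (hI : ∀ i j, I i j =
      ((-1 : ℝ) ^ ((i : ℕ) + (j : ℕ))) • (A₀ ⊗ₖ (B₀ - B₁))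
        + ((-1 : ℝ) ^ (i : ℕ)) • (A₁ ⊗ₖ (B₀ + B₁)))
    (hpos : ∀ i j,
      0 < ((((1 : Matrix (Fin dA) (Fin dA) ℂ) ⊗ₖ (1 : Matrix (Fin dB) (Fin dB) ℂ))
            ⊗ₖ N i j) * ρ).trace)
    (hmax : ∑ i, ∑ j, ((I i j ⊗ₖ N i j) * ρ).trace
      = ((2 * Real.sqrt 2 : ℝ) : ℂ)) :
    ∀ i j, ((I i j ⊗ₖ N i j) * ρ).trace
      = ((2 * Real.sqrt 2 : ℝ) : ℂ)
        * ((((1 : Matrix (Fin dA) (Fin dA) ℂ) ⊗ₖ (1 : Matrix (Fin dB) (Fin dB) ℂ))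
            ⊗ₖ N i j) * ρ).trace := by
  have hAA : ∀ (c : ℝ) (A : Matrix (Fin dA) (Fin dA) ℂ), A.IsHermitian →
      ((c • A) ⊗ₖ (1 : Matrix (Fin dB) (Fin dB) ℂ)).IsHermitian := fun c A hA =>
    (hA.smul (IsSelfAdjoint.all c)).kronecker isHermitian_one
  have hAsq : ∀ (c : ℝ) (A : Matrix (Fin dA) (Fin dA) ℂ), c * c = 1 → (1 - A * A).PosSemidef →
      (1 - ((c • A) ⊗ₖ (1 : Matrix (Fin dB) (Fin dB) ℂ)) * ((c • A) ⊗ₖ 1)).PosSemidef := by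
    intro c A hc hA
    have h := hA.kronecker (PosSemidef.one (n := Fin dB) (R := ℂ))
    rwa [sub_kronecker, one_kronecker_one, ← mul_one (1 : Matrix (Fin dB) (Fin dB) ℂ),
      mul_kronecker_mul, ← one_smul ℝ (_ * _ : Matrix (Fin dA × Fin dB) _ ℂ), ← hc,
      ← smul_mul_smul_comm, ← smul_kronecker] at h
  have hBsq : ∀ B : Matrix (Fin dB) (Fin dB) ℂ, (1 - B * B).PosSemidef →
      (1 - ((1 : Matrix (Fin dA) (Fin dA) ℂ) ⊗ₖ B) * (1 ⊗ₖ B)).PosSemidef := by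
    intro B hB
    have h := (PosSemidef.one (n := Fin dA) (R := ℂ)).kronecker hB
    rwa [kronecker_sub, one_kronecker_one, ← mul_one (1 : Matrix (Fin dA) (Fin dA) ℂ),
      mul_kronecker_mul] at h
  have hcomm : ∀ (A : Matrix (Fin dA) (Fin dA) ℂ) (B : Matrix (Fin dB) (Fin dB) ℂ),
      Commute (A ⊗ₖ (1 : Matrix (Fin dB) (Fin dB) ℂ)) (1 ⊗ₖ B) := by
    intro A B
    simp [Commute, SemiconjBy, ← mul_kronecker_mul]
  have hsign : ∀ k : ℕ, (-1 : ℝ) ^ k * (-1) ^ k = 1 := fun k => by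
    rw [← mul_pow]; simp
  have hgap : ∀ i j, ((2 * √2) • 1 - I i j).PosSemidef := by
    intro i j
    have h := posSemidef_two_sqrt_two_sub_chsh
      (hAA ((-1) ^ ((i : ℕ) + (j : ℕ))) A₀ hA₀) (hAA ((-1) ^ (i : ℕ)) A₁ hA₁)
      (isHermitian_one.kronecker hB₀) (isHermitian_one.kronecker hB₁)
      (hAsq _ _ (hsign _) hA₀sq) (hAsq _ _ (hsign _) hA₁sq) (hBsq _ hB₀sq) (hBsq _ hB₁sq)
      (hcomm _ _) (hcomm _ _) (hcomm _ _) (hcomm _ _)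
    rwa [← kronecker_sub, ← kronecker_add, ← mul_kronecker_mul, ← mul_kronecker_mul, mul_one,
      mul_one, one_mul, one_mul, smul_kronecker, smul_kronecker, ← hI] at h
  have hexp : ∀ i j, ((((2 * √2) • 1 - I i j) ⊗ₖ N i j) * ρ).trace
      = ((2 * √2 : ℝ) : ℂ) * (((1 ⊗ₖ 1) ⊗ₖ N i j) * ρ).trace - ((I i j ⊗ₖ N i j) * ρ).trace := by
    intro i j
    rw [sub_kronecker, sub_mul, trace_sub, smul_kronecker, smul_mul_assoc, trace_smul,
      Complex.real_smul, one_kronecker_one]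
  have hnonneg : ∀ i j, 0 ≤ ((((2 * √2) • 1 - I i j) ⊗ₖ N i j) * ρ).trace := fun i j =>
    ((hgap i j).kronecker (hN i j)).trace_mul_nonneg hρpsd
  have hprob : ∑ i, ∑ j, ((((1 : Matrix (Fin dA) (Fin dA) ℂ) ⊗ₖ (1 : Matrix (Fin dB) (Fin dB) ℂ))
      ⊗ₖ N i j) * ρ).trace = 1 := by
    simp_rw [← trace_sum, ← Finset.sum_mul, ← kronecker_sum, hNsum, one_kronecker_one, one_mul,
      hρtr]
  have hsum : ∑ i, ∑ j, ((((2 * √2) • 1 - I i j) ⊗ₖ N i j) * ρ).trace = 0 := by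
    simp_rw [hexp, Finset.sum_sub_distrib, ← Finset.mul_sum, hprob, hmax, mul_one, sub_self]
  intro i j
  have hi := (Finset.sum_eq_zero_iff_of_nonneg
    fun i _ => Finset.sum_nonneg fun j _ => hnonneg i j).1 hsum i (Finset.mem_univ i)
  have hij := (Finset.sum_eq_zero_iff_of_nonneg fun j _ => hnonneg i j).1 hi j (Finset.mem_univ j)
  rw [hexp] at hij
  exact (sub_eq_zero.1 hij).symm
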